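/- Let φ be a spherically symmetric wave on D whose horizon limits φ_H and φ_H' exist, and suppose F_p[φ] := ∫_{−∞}^{u₀} |u'|^p·|∂_u φ|(u',v₀) du' + ∫_{v₀}^{∞} |φ_H'(v')| dv' < ∞ for some 0 ≤ p < 1. Let V : [v₀,∞) → [V₀,M) be defined by V(v) := r(u₀,v), where V₀ := r(u₀,v₀); V is a smooth strictly increasing bijection with V(v) → M as v → ∞. Then there exists a continuous function Φ : (−∞,u₀] × [V₀,M] → ℝ such that Φ(u, V(v)) = φ(u,v) for all (u,v) ∈ (−∞,u₀] × [v₀,∞); that is, φ extends continuously to the Cauchy horizon V = M. -/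

import Mathlib

open Filter MeasureTheory Set Topology intervalIntegral

noncomputable section

/-- The extremal Reissner--Nordström tortoise function. -/
def rstar (M ρ : ℝ) : ℝ := M ^ 2 / (M - ρ) + 2 * M * Real.log (M - ρ) + ρ

/-- The data of a spherically symmetric wave on the interior region
`D = (-∞, u₀] × [v₀, ∞)` of extremal Reissner--Nordström: the radius function `r`,
the wave `φ` together with its partial derivatives, and the wave equation. -/
structure WaveSetup (M u₀ v₀ : ℝ) where
  hM : 0 < M
  hu₀ : u₀ < 0
  hv₀ : 0 < v₀
  hdom : M + 2 * M * Real.log M < v₀ - u₀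
  /-- the area radius function, defined implicitly by `rstar M (r u v) = v - u` -/
  r : ℝ → ℝ → ℝ
  hr_mem : ∀ u v : ℝ, M + 2 * M * Real.log M < v - u → r u v ∈ Set.Ioo 0 M
  hr_star : ∀ u v : ℝ, M + 2 * M * Real.log M < v - u → rstar M (r u v) = v - u
  /-- the wave -/
  φ : ℝ → ℝ → ℝ
  /-- `∂_u φ` -/
  φu : ℝ → ℝ → ℝ
  /-- `∂_v φ` -/
  φv : ℝ → ℝ → ℝ
  /-- `∂_v ∂_u φ` -/
  φuv : ℝ → ℝ → ℝ
  /-- `∂_v ∂_v φ` -/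
  φvv : ℝ → ℝ → ℝ
  hφu : ∀ u ∈ Set.Iic u₀, ∀ v ∈ Set.Ici v₀,
    HasDerivWithinAt (fun u' => φ u' v) (φu u v) (Set.Iic u₀) u
  hφv : ∀ u ∈ Set.Iic u₀, ∀ v ∈ Set.Ici v₀,
    HasDerivWithinAt (fun v' => φ u v') (φv u v) (Set.Ici v₀) v
  hφuv : ∀ u ∈ Set.Iic u₀, ∀ v ∈ Set.Ici v₀,
    HasDerivWithinAt (fun v' => φu u v') (φuv u v) (Set.Ici v₀) v
  hφvv : ∀ u ∈ Set.Iic u₀, ∀ v ∈ Set.Ici v₀,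
    HasDerivWithinAt (fun v' => φv u v') (φvv u v) (Set.Ici v₀) v
  hφ_cont : ContinuousOn (fun p : ℝ × ℝ => φ p.1 p.2) (Set.Iic u₀ ×ˢ Set.Ici v₀)
  hφu_cont : ContinuousOn (fun p : ℝ × ℝ => φu p.1 p.2) (Set.Iic u₀ ×ˢ Set.Ici v₀)
  hφv_cont : ContinuousOn (fun p : ℝ × ℝ => φv p.1 p.2) (Set.Iic u₀ ×ˢ Set.Ici v₀)
  /-- the wave equation `r ∂_u∂_v φ + (∂_u r) ∂_v φ + (∂_v r) ∂_u φ = 0`,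
  with `∂_u r = -Ω²` and `∂_v r = Ω²`, `Ω² = (1 - M/r)²`. -/
  hwave : ∀ u ∈ Set.Iic u₀, ∀ v ∈ Set.Ici v₀,
    r u v * φuv u v - (1 - M / r u v) ^ 2 * φv u v + (1 - M / r u v) ^ 2 * φu u v = 0

namespace WaveSetup

variable {M u₀ v₀ : ℝ}

/-- The conformal factor `Ω²(u,v) = (1 - M/r(u,v))²`. -/
def Ω2 (W : WaveSetup M u₀ v₀) (u v : ℝ) : ℝ := (1 - M / W.r u v) ^ 2

/-- The regular outgoing derivative `∂_V φ = Ω⁻²(u₀,v) ∂_v φ`. -/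
def dVφ (W : WaveSetup M u₀ v₀) (u v : ℝ) : ℝ := (W.Ω2 u₀ v)⁻¹ * W.φv u v

/-- The regular outgoing derivative of `r φ`:
`∂_V (r φ) = Ω⁻²(u₀,v) (∂_v r · φ + r ∂_v φ)` with `∂_v r = Ω²(u,v)`. -/
def dVrφ (W : WaveSetup M u₀ v₀) (u v : ℝ) : ℝ :=
  (W.Ω2 u₀ v)⁻¹ * (W.Ω2 u v * W.φ u v + W.r u v * W.φv u v)

/-- The second regular outgoing derivative `∂_V² φ = Ω⁻²(u₀,v) ∂_v (∂_V φ)`,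
computed using `∂_v Ω²(u₀,v) = 2 (1 - M/r)(M/r²) Ω²(u₀,v)`. -/
def dV2φ (W : WaveSetup M u₀ v₀) (u v : ℝ) : ℝ :=
  ((W.Ω2 u₀ v)⁻¹) ^ 2 * W.φvv u v
    - 2 * (1 - M / W.r u₀ v) * (M / (W.r u₀ v) ^ 2) * ((W.Ω2 u₀ v)⁻¹) ^ 2 * W.φv u v

/-- `∂_u (r φ) = (∂_u r) φ + r ∂_u φ = -Ω² φ + r ∂_u φ`. -/
def duRφ (W : WaveSetup M u₀ v₀) (u v : ℝ) : ℝ :=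
  -W.Ω2 u v * W.φ u v + W.r u v * W.φu u v

end WaveSetup

/-- A spherically symmetric wave whose horizon limits exist:
`φ_H(v) = lim_{u → -∞} φ(u,v)` and `φ_H'(v) = lim_{u → -∞} ∂_v φ(u,v)` exist
locally uniformly in `v`, with `φ_H` differentiable and `(φ_H)' = φ_H'`. -/
structure WaveSetupH (M u₀ v₀ : ℝ) extends WaveSetup M u₀ v₀ where
  φH : ℝ → ℝ
  φH' : ℝ → ℝ
  hφH_tendsto : TendstoLocallyUniformlyOn (fun u v => φ u v) φH Filter.atBot (Set.Ici v₀)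
  hφH'_tendsto : TendstoLocallyUniformlyOn (fun u v => φv u v) φH' Filter.atBot (Set.Ici v₀)
  hφH_deriv : ∀ v ∈ Set.Ici v₀, HasDerivWithinAt φH (φH' v) (Set.Ici v₀) v

end

lemma integral_eq_sub_of_hasDerivWithinAt_Icc {f g : ℝ → ℝ} {a b : ℝ} (hab : a ≤ b)
    (hg : Continuous g) (hf : ∀ x ∈ Icc a b, HasDerivWithinAt f (g x) (Icc a b) x) :
    ∫ x in a..b, g x = f b - f a :=
  integral_eq_sub_of_hasDerivAt_of_le hab (fun x hx => (hf x hx).continuousWithinAt)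
    (fun x hx => (hf x (Ioo_subset_Icc_self hx)).hasDerivAt (Icc_mem_nhds hx.1 hx.2))
    (hg.intervalIntegrable a b)

/-- A continuous function on a closed quadrant extends to a continuous function on the plane. -/
lemma exists_continuous_extension_quadrant {g : ℝ → ℝ → ℝ} {a b : ℝ}
    (hg : ContinuousOn (fun p : ℝ × ℝ => g p.1 p.2) (Iic a ×ˢ Ici b)) :
    ∃ G : ℝ → ℝ → ℝ, Continuous (Function.uncurry G) ∧ ∀ u ≤ a, ∀ v ≥ b, G u v = g u v := by
  refine ⟨fun u v => g (min u a) (max v b), ?_, fun u hu v hv => ?_⟩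
  · exact hg.comp_continuous (f := fun p : ℝ × ℝ => (min p.1 a, max p.2 b)) (by fun_prop)
      (fun p => ⟨min_le_right p.1 a, le_max_right p.2 b⟩)
  · simp only [min_eq_left hu, max_eq_left hv]

/-- Symmetry of mixed partial derivatives, in integrated form. -/
lemma sub_eq_integral_mixed_partial {f A B F : ℝ → ℝ → ℝ} {u₁ u v₀ : ℝ}
    (hF : Continuous (Function.uncurry F))
    (hA : ∀ v ≥ v₀, ∫ x in u₁..u, A x v = f u v - f u₁ v)
    (hAc : Continuous (Function.uncurry A)) (hu : u₁ ≤ u)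
    (hAF : ∀ x ∈ Icc u₁ u, ∀ v ≥ v₀, ∫ y in v₀..v, F x y = A x v - A x v₀)
    (hB : ∀ v ≥ v₀, HasDerivWithinAt (f u) (B u v) (Ici v₀) v)
    (hB₁ : ∀ v ≥ v₀, HasDerivWithinAt (f u₁) (B u₁ v) (Ici v₀) v) (v : ℝ) (hv : v₀ ≤ v) :
    B u v - B u₁ v = ∫ x in u₁..u, F x v := by
  have hF' : Continuous (Function.uncurry fun y x => F x y) := hF.comp continuous_swap
  have hH : Continuous fun y => ∫ x in u₁..u, F x y :=
    continuous_parametric_intervalIntegral_of_continuous' hF' u₁ u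
  have hAi : ∀ y, IntervalIntegrable (fun x => A x y) volume u₁ u := fun y =>
    (hAc.comp (by fun_prop : Continuous fun x : ℝ => (x, y))).intervalIntegrable _ _
  have key : ∀ y ≥ v₀, f u y - f u₁ y
      = (f u v₀ - f u₁ v₀) + ∫ z in v₀..y, ∫ x in u₁..u, F x z := by
    intro y hy
    have h1 : ∫ z in v₀..y, ∫ x in u₁..u, F x z = ∫ x in u₁..u, ∫ z in v₀..y, F x z := by
      refine intervalIntegral_intervalIntegral_swap (F := fun z x => F x z) ?_
      refine (hF'.continuousOn.integrableOn_compact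
        (isCompact_uIcc.prod isCompact_uIcc)).mono_set
        (prod_mono uIoc_subset_uIcc uIoc_subset_uIcc)
    have h2 : ∫ x in u₁..u, ∫ z in v₀..y, F x z = ∫ x in u₁..u, (A x y - A x v₀) := by
      refine intervalIntegral.integral_congr fun x hx => ?_
      rw [uIcc_of_le hu] at hx
      exact hAF x hx y hy
    rw [h1, h2, intervalIntegral.integral_sub (hAi y) (hAi v₀), hA y hy, hA v₀ le_rfl]
    ring
  have d1 : HasDerivWithinAt (fun y => f u y - f u₁ y) (B u v - B u₁ v) (Ici v₀) v :=
    (hB v hv).sub (hB₁ v hv)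
  have d2 : HasDerivWithinAt (fun y => f u y - f u₁ y) (∫ x in u₁..u, F x v) (Ici v₀) v := by
    refine (((hH.integral_hasStrictDerivAt v₀ v).hasDerivAt.hasDerivWithinAt).const_add
      (f u v₀ - f u₁ v₀)).congr (fun y hy => key y hy) (key v hv)
  exact (uniqueDiffOn_Ici v₀ v hv).eq_deriv _ d1 d2

/-- Grönwall's inequality in integral form. -/
lemma integral_gronwall {g k : ℝ → ℝ} {a b C L : ℝ} (hg : Continuous g) (hk : Continuous k)
    (hk0 : ∀ x, 0 ≤ k x) (hL : 0 ≤ L)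
    (h : ∀ x ∈ Icc a b, g x ≤ C + L * ∫ y in a..x, k y * g y) {x : ℝ} (hx : x ∈ Icc a b) :
    C + L * ∫ y in a..x, k y * g y ≤ C * Real.exp (L * ∫ y in a..x, k y) := by
  set G : ℝ → ℝ := fun x => ∫ y in a..x, k y * g y with hG
  set κ : ℝ → ℝ := fun x => ∫ y in a..x, k y with hκ
  have dG : ∀ x, HasDerivAt G (k x * g x) x := fun x =>
    ((hk.mul hg).integral_hasStrictDerivAt a x).hasDerivAt
  have dκ : ∀ x, HasDerivAt κ (k x) x := fun x => (hk.integral_hasStrictDerivAt a x).hasDerivAt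
  have dE : ∀ x, HasDerivAt (fun x => (C + L * G x) * Real.exp (-(L * κ x)))
      ((L * (k x * g x)) * Real.exp (-(L * κ x))
        + (C + L * G x) * (Real.exp (-(L * κ x)) * (-(L * k x)))) x := fun x =>
    (((dG x).const_mul L).const_add C).mul (((dκ x).const_mul L).neg.exp)
  have anti : AntitoneOn (fun x => (C + L * G x) * Real.exp (-(L * κ x))) (Icc a b) := by
    refine antitoneOn_of_deriv_nonpos (convex_Icc a b)
      (fun x _ => (dE x).continuousAt.continuousWithinAt)
      (fun x _ => (dE x).differentiableAt.differentiableWithinAt) fun x hx => ?_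
    rw [(dE x).deriv]
    have h1 := h x (interior_subset hx)
    have : (L * (k x * g x)) * Real.exp (-(L * κ x))
        + (C + L * G x) * (Real.exp (-(L * κ x)) * (-(L * k x)))
        = -(L * k x * Real.exp (-(L * κ x)) * ((C + L * G x) - g x)) := by ring
    rw [this, neg_nonpos]
    exact mul_nonneg (mul_nonneg (mul_nonneg hL (hk0 x)) (Real.exp_pos _).le) (by linarith)
  have h0 := anti ⟨le_rfl, hx.1.trans hx.2⟩ hx hx.1
  have e0 : (C + L * G a) * Real.exp (-(L * κ a)) = C := by simp [hG, hκ]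
  simp only [e0] at h0
  rw [Real.exp_neg, ← div_eq_mul_inv, div_le_iff₀ (Real.exp_pos _)] at h0
  exact h0

/-- Grönwall-type bound for the characteristic system `∂_v P = b Q`, `∂_u Q = -b P`. -/
lemma abs_le_of_characteristic_system {b P Q : ℝ → ℝ → ℝ} {k w : ℝ → ℝ}
    {u₀ u₁ v₀ V L N C₀ : ℝ}
    (hPc : Continuous (Function.uncurry P))
    (hQc : Continuous (Function.uncurry Q)) (hk : Continuous k) (hw : Continuous w)
    (hk0 : ∀ u, 0 ≤ k u) (hw0 : ∀ v, 0 ≤ w v) (hL : 0 < L)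
    (hbk : ∀ u ≤ u₀, ∀ v ≥ v₀, |b u v| ≤ k u) (hbw : ∀ u ≤ u₀, ∀ v ≥ v₀, |b u v| ≤ w v)
    (hkN : ∫ u in u₁..u₀, k u ≤ N) (hwL : ∫ v in v₀..V, w v ≤ L)
    (hP : ∀ u ≤ u₀, ∀ v ≥ v₀, ∫ y in v₀..v, b u y * Q u y = P u v - P u v₀)
    (hQ : ∀ u ≤ u₀, u₁ ≤ u → ∀ v ≥ v₀, ∫ x in u₁..u, b x v * P x v = Q u₁ v - Q u v)
    (hC₀ : ∫ x in u₁..u₀, |P x v₀| ≤ C₀) (hV : v₀ ≤ V)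
    {u v : ℝ} (hu₁ : u₁ ≤ u) (hu : u ≤ u₀) (hv : v ∈ Icc v₀ V) :
    |Q u v| ≤ |Q u₁ v| +
      w v * (C₀ + ((∫ y in v₀..V, |Q u₁ y|) + L * C₀) * Real.exp (L * N) / L) := by
  have cu : ∀ {f : ℝ → ℝ → ℝ}, Continuous (Function.uncurry f) → ∀ v, Continuous fun u => f u v :=
    fun hf v => hf.comp (by fun_prop : Continuous fun x : ℝ => (x, v))
  have cv : ∀ {f : ℝ → ℝ → ℝ}, Continuous (Function.uncurry f) → ∀ u, Continuous (f u) :=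
    fun hf u => hf.comp (by fun_prop : Continuous fun x : ℝ => (u, x))
  set g : ℝ → ℝ := fun u => ∫ y in v₀..V, |Q u y| with hgdef
  have hg : Continuous g :=
    continuous_parametric_intervalIntegral_of_continuous' (f := fun u y => |Q u y|) hQc.abs v₀ V
  have hg0 : ∀ u, 0 ≤ g u := fun u =>
    intervalIntegral.integral_nonneg hV fun _ _ => abs_nonneg _
  have hPb : ∀ u ≤ u₀, ∀ v ∈ Icc v₀ V, |P u v| ≤ |P u v₀| + k u * g u := by
    intro u hu v hv
    have h1 : |P u v - P u v₀| ≤ ∫ y in v₀..v, k u * |Q u y| := by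
      rw [← hP u hu v hv.1, ← Real.norm_eq_abs]
      refine intervalIntegral.norm_integral_le_of_norm_le hv.1
        (Eventually.of_forall fun y hy => ?_)
        ((continuous_const.mul (cv hQc u).abs).intervalIntegrable _ _)
      rw [Real.norm_eq_abs, abs_mul]
      exact mul_le_mul_of_nonneg_right (hbk u hu y hy.1.le) (abs_nonneg _)
    have h2 : ∫ y in v₀..v, |Q u y| ≤ g u :=
      intervalIntegral.integral_mono_interval le_rfl hv.1 hv.2
        (Eventually.of_forall fun _ => abs_nonneg _) ((cv hQc u).abs.intervalIntegrable _ _)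
    rw [intervalIntegral.integral_const_mul] at h1
    have h3 := mul_le_mul_of_nonneg_left h2 (hk0 u)
    have h4 := abs_sub_abs_le_abs_sub (P u v) (P u v₀)
    linarith
  have hQb : ∀ u ≤ u₀, u₁ ≤ u → ∀ v ∈ Icc v₀ V,
      |Q u v| ≤ |Q u₁ v| + w v * (C₀ + ∫ x in u₁..u, k x * g x) := by
    intro u hu hu₁ v hv
    have hi : Continuous fun x => |P x v₀| + k x * g x := (cu hPc v₀).abs.add (hk.mul hg)
    have hkg : Continuous fun x => k x * g x := hk.mul hg
    have h1 : |Q u₁ v - Q u v| ≤ ∫ x in u₁..u, w v * (|P x v₀| + k x * g x) := by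
      rw [← hQ u hu hu₁ v hv.1, ← Real.norm_eq_abs]
      refine intervalIntegral.norm_integral_le_of_norm_le hu₁
        (Eventually.of_forall fun x hx => ?_) ((continuous_const.mul hi).intervalIntegrable _ _)
      rw [Real.norm_eq_abs, abs_mul]
      exact mul_le_mul (hbw x (hx.2.trans hu) v hv.1) (hPb x (hx.2.trans hu) v hv)
        (abs_nonneg _) (hw0 v)
    have h2 : ∫ x in u₁..u, |P x v₀| ≤ C₀ :=
      (intervalIntegral.integral_mono_interval le_rfl hu₁ hu
        (Eventually.of_forall fun _ => abs_nonneg _)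
        ((cu hPc v₀).abs.intervalIntegrable _ _)).trans hC₀
    rw [intervalIntegral.integral_const_mul, intervalIntegral.integral_add
      ((cu hPc v₀).abs.intervalIntegrable _ _) (hkg.intervalIntegrable _ _)] at h1
    have h3 := mul_le_mul_of_nonneg_left
      (add_le_add_left h2 (∫ x in u₁..u, k x * g x)) (hw0 v)
    have h4 := abs_sub_abs_le_abs_sub (Q u v) (Q u₁ v)
    rw [abs_sub_comm] at h4
    linarith
  have hkg0 : ∀ u, u₁ ≤ u → 0 ≤ ∫ x in u₁..u, k x * g x := fun u hu =>
    intervalIntegral.integral_nonneg hu fun x _ => mul_nonneg (hk0 x) (hg0 x)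
  have hC₀' : 0 ≤ C₀ :=
    (intervalIntegral.integral_nonneg (hu₁.trans hu) fun _ _ => abs_nonneg _).trans hC₀
  have hgb : ∀ u ∈ Icc u₁ u₀, g u ≤ (g u₁ + L * C₀) + L * ∫ x in u₁..u, k x * g x := by
    intro u hu
    have hwc : Continuous fun y => w y * (C₀ + ∫ x in u₁..u, k x * g x) :=
      hw.mul continuous_const
    have h1 : g u ≤ ∫ y in v₀..V, (|Q u₁ y| + w y * (C₀ + ∫ x in u₁..u, k x * g x)) := by
      refine intervalIntegral.integral_mono_on hV ((cv hQc u).abs.intervalIntegrable _ _) ?_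
        fun y hy => hQb u hu.2 hu.1 y hy
      exact ((cv hQc u₁).abs.add hwc).intervalIntegrable _ _
    rw [intervalIntegral.integral_add ((cv hQc u₁).abs.intervalIntegrable _ _)
      (hwc.intervalIntegrable _ _),
      intervalIntegral.integral_mul_const] at h1
    have h2 := mul_le_mul_of_nonneg_right hwL (add_nonneg hC₀' (hkg0 u hu.1))
    linarith
  have hfin := integral_gronwall hg hk hk0 hL.le hgb ⟨hu₁, hu⟩
  have hC1 : 0 ≤ g u₁ + L * C₀ := add_nonneg (hg0 u₁) (mul_nonneg hL.le hC₀')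
  have hkN' : ∫ x in u₁..u, k x ≤ N :=
    (intervalIntegral.integral_mono_interval le_rfl hu₁ hu
      (Eventually.of_forall hk0) (hk.intervalIntegrable _ _)).trans hkN
  have hexp : (g u₁ + L * C₀) * Real.exp (L * ∫ x in u₁..u, k x)
      ≤ (g u₁ + L * C₀) * Real.exp (L * N) :=
    mul_le_mul_of_nonneg_left (Real.exp_le_exp.2 (mul_le_mul_of_nonneg_left hkN' hL.le)) hC1
  have hG : ∫ x in u₁..u, k x * g x ≤ (g u₁ + L * C₀) * Real.exp (L * N) / L := by
    rw [le_div_iff₀ hL]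
    linarith
  refine (hQb u hu hu₁ v hv).trans ?_
  have := mul_le_mul_of_nonneg_left (add_le_add_right hG C₀) (hw0 v)
  linarith

lemma hasDerivAt_rstar {M ρ : ℝ} (hρ : ρ < M) :
    HasDerivAt (rstar M) ((ρ / (M - ρ)) ^ 2) ρ := by
  have h : M - ρ ≠ 0 := (sub_pos.2 hρ).ne'
  have d0 : HasDerivAt (fun x => M - x) (-1) ρ := (hasDerivAt_id ρ).const_sub M
  have d := (((hasDerivAt_const ρ (M ^ 2)).div d0 h).add
    ((d0.log h).const_mul (2 * M))).add (hasDerivAt_id ρ)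
  refine d.congr_deriv ?_
  field_simp
  ring

lemma strictMonoOn_rstar (M : ℝ) : StrictMonoOn (rstar M) (Ico 0 M) := by
  refine strictMonoOn_of_deriv_pos (convex_Ico 0 M)
    (fun x hx => (hasDerivAt_rstar hx.2).continuousAt.continuousWithinAt) fun x hx => ?_
  rw [interior_Ico] at hx
  rw [(hasDerivAt_rstar hx.2).deriv]
  exact pow_pos (div_pos hx.1 (sub_pos.2 hx.2)) 2

lemma rstar_zero (M : ℝ) : rstar M 0 = M + 2 * M * Real.log M := by
  simp [rstar, sq]

namespace WaveSetup

variable {M u₀ v₀ : ℝ} (W : WaveSetup M u₀ v₀)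

lemma rstar_gt {x : ℝ} (hx : x ∈ Ioo 0 M) : M + 2 * M * Real.log M < rstar M x := by
  rw [← rstar_zero M]
  exact strictMonoOn_rstar M ⟨le_rfl, hx.1.trans hx.2⟩ (Ioo_subset_Ico_self hx) hx.1

include W in
lemma dom_of_le {u v : ℝ} (hu : u ≤ u₀) (hv : v₀ ≤ v) :
    M + 2 * M * Real.log M < v - u := by
  linarith [W.hdom]

include W in
lemma sub_pos_of_le {u v : ℝ} (hu : u ≤ u₀) (hv : v₀ ≤ v) : 0 < v - u := by
  linarith [W.hu₀, W.hv₀]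

lemma r_eq {u v x : ℝ} (hx : x ∈ Ioo 0 M) (h : rstar M x = v - u) : W.r u v = x := by
  have hd : M + 2 * M * Real.log M < v - u := h ▸ rstar_gt hx
  exact (strictMonoOn_rstar M).injOn (Ioo_subset_Ico_self (W.hr_mem u v hd))
    (Ioo_subset_Ico_self hx) ((W.hr_star u v hd).trans h.symm)

lemma r_lt_r {u v u' v' : ℝ} (hd : M + 2 * M * Real.log M < v - u) (h : v - u < v' - u') :
    W.r u v < W.r u' v' := by
  have hd' := hd.trans h
  rw [← (strictMonoOn_rstar M).lt_iff_lt (Ioo_subset_Ico_self (W.hr_mem u v hd))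
    (Ioo_subset_Ico_self (W.hr_mem u' v' hd')), W.hr_star u v hd, W.hr_star u' v' hd']
  exact h

/-- The radius as a function of `v - u`. -/
lemma hasDerivAt_r_zero {s : ℝ} (hs : M + 2 * M * Real.log M < s) :
    HasDerivAt (W.r 0) ((1 - M / W.r 0 s) ^ 2) s := by
  have hd : ∀ {t : ℝ}, t ∈ Ioi (M + 2 * M * Real.log M) → M + 2 * M * Real.log M < t - 0 := by
    intro t ht
    simpa using ht
  have hmono : StrictMonoOn (W.r 0) (Ioi (M + 2 * M * Real.log M)) := fun a ha b _ hab =>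
    W.r_lt_r (hd ha) (by linarith)
  have himg : Ioo 0 M ⊆ W.r 0 '' Ioi (M + 2 * M * Real.log M) := fun x hx =>
    ⟨rstar M x, rstar_gt hx, W.r_eq hx (by simp)⟩
  have hmem := W.hr_mem 0 s (hd hs)
  have hcont : ContinuousAt (W.r 0) s := hmono.continuousAt_of_image_mem_nhds
    (Ioi_mem_nhds hs) (mem_of_superset (Ioo_mem_nhds hmem.1 hmem.2) himg)
  have hM' : 0 < M - W.r 0 s := sub_pos.2 hmem.2
  have hr0 := hmem.1
  have := HasDerivAt.of_local_left_inverse hcont (hasDerivAt_rstar hmem.2)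
    (pow_pos (div_pos hmem.1 hM') 2).ne' (by
      filter_upwards [Ioi_mem_nhds hs] with t ht
      simpa using W.hr_star 0 t (hd ht))
  refine this.congr_deriv ?_
  rw [← inv_pow, inv_div, sub_div, div_self hr0.ne']
  ring

lemma r_eq_r_zero {u v : ℝ} (hd : M + 2 * M * Real.log M < v - u) : W.r u v = W.r 0 (v - u) :=
  W.r_eq (W.hr_mem 0 (v - u) (by simpa using hd))
    (by simpa using W.hr_star 0 (v - u) (by simpa using hd))

lemma hasDerivAt_r_v {u v : ℝ} (hd : M + 2 * M * Real.log M < v - u) :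
    HasDerivAt (fun y => W.r u y) (W.Ω2 u v) v := by
  have h := (W.hasDerivAt_r_zero hd).comp v ((hasDerivAt_id v).sub_const u)
  rw [Ω2, W.r_eq_r_zero hd]
  simp only [mul_one] at h
  refine h.congr_of_eventuallyEq ?_
  filter_upwards [((continuous_id.sub continuous_const).isOpen_preimage _
    (isOpen_Ioi (a := M + 2 * M * Real.log M))).mem_nhds hd] with y hy
  exact W.r_eq_r_zero hy

lemma hasDerivAt_r_u {u v : ℝ} (hd : M + 2 * M * Real.log M < v - u) :
    HasDerivAt (fun x => W.r x v) (-W.Ω2 u v) u := by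
  have h := (W.hasDerivAt_r_zero hd).comp u ((hasDerivAt_id u).const_sub v)
  rw [Ω2, W.r_eq_r_zero hd]
  simp only [mul_neg, mul_one] at h
  refine h.congr_of_eventuallyEq ?_
  filter_upwards [((continuous_const.sub continuous_id).isOpen_preimage _
    (isOpen_Ioi (a := M + 2 * M * Real.log M))).mem_nhds hd] with x hx
  exact W.r_eq_r_zero hx

lemma continuousOn_r :
    ContinuousOn (fun p : ℝ × ℝ => W.r p.1 p.2) (Iic u₀ ×ˢ Ici v₀) := by
  have h : ContinuousOn (fun p : ℝ × ℝ => W.r 0 (p.2 - p.1)) (Iic u₀ ×ˢ Ici v₀) := by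
    intro p hp
    exact ((W.hasDerivAt_r_zero (W.dom_of_le hp.1 hp.2)).continuousAt.comp
      (f := fun p : ℝ × ℝ => p.2 - p.1) (by fun_prop)).continuousWithinAt
  exact h.congr fun p hp => W.r_eq_r_zero (W.dom_of_le hp.1 hp.2)

lemma r_pos {u v : ℝ} (hu : u ≤ u₀) (hv : v₀ ≤ v) : 0 < W.r u v :=
  (W.hr_mem u v (W.dom_of_le hu hv)).1

lemma r_lt {u v : ℝ} (hu : u ≤ u₀) (hv : v₀ ≤ v) : W.r u v < M :=
  (W.hr_mem u v (W.dom_of_le hu hv)).2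

lemma r_ge {u v : ℝ} (hu : u ≤ u₀) (hv : v₀ ≤ v) : W.r u₀ v₀ ≤ W.r u v := by
  rcases eq_or_lt_of_le (show v₀ - u₀ ≤ v - u by linarith) with h | h
  · exact (W.r_eq (W.hr_mem u v (W.dom_of_le hu hv))
      ((W.hr_star u v (W.dom_of_le hu hv)).trans h.symm)).le
  · exact (W.r_lt_r W.hdom h).le

lemma continuousOn_Ω2_div_r :
    ContinuousOn (fun p : ℝ × ℝ => W.Ω2 p.1 p.2 / W.r p.1 p.2) (Iic u₀ ×ˢ Ici v₀) := by
  have hr : ∀ p ∈ Iic u₀ ×ˢ Ici v₀, W.r p.1 p.2 ≠ 0 := fun p hp => (W.r_pos hp.1 hp.2).ne'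
  unfold Ω2
  exact ((continuousOn_const.sub (continuousOn_const.div W.continuousOn_r hr)).pow 2).div
    W.continuousOn_r hr

lemma exists_Ω2_div_r_le : ∃ K > 0, ∀ u ≤ u₀, ∀ v ≥ v₀, W.Ω2 u v / W.r u v ≤ K / (v - u) ^ 2 := by
  have hM := W.hM
  set c := M ^ 2 + M * |2 * M * Real.log M + M| with hc
  set m := W.r u₀ v₀ with hm
  have hm0 : 0 < m := W.r_pos le_rfl le_rfl
  have hc0 : 0 < c := by positivity
  refine ⟨c ^ 2 / m ^ 3, by positivity, fun u hu v hv => ?_⟩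
  have hr0 := W.r_pos hu hv
  have hrM := W.r_lt hu hv
  have hrm : m ≤ W.r u v := W.r_ge hu hv
  have hs := W.hr_star u v (W.dom_of_le hu hv)
  have hs0 := W.sub_pos_of_le hu hv
  set ρ := W.r u v with hρ
  have hd : 0 < M - ρ := sub_pos.2 hrM
  have hlog : Real.log (M - ρ) ≤ Real.log M := Real.log_le_log hd (by linarith)
  have h1 : (v - u) * (M - ρ) ≤ c := by
    rw [← hs, rstar]
    have e : (M ^ 2 / (M - ρ) + 2 * M * Real.log (M - ρ) + ρ) * (M - ρ)
        = M ^ 2 + (M - ρ) * (2 * M * Real.log (M - ρ) + ρ) := by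
      field_simp
      ring
    rw [e, hc]
    have h2 : 2 * M * Real.log (M - ρ) + ρ ≤ |2 * M * Real.log M + M| := by
      refine le_trans ?_ (le_abs_self _)
      have := mul_le_mul_of_nonneg_left hlog (by positivity : 0 ≤ 2 * M)
      linarith
    have h3 : (M - ρ) * (2 * M * Real.log (M - ρ) + ρ) ≤ (M - ρ) * |2 * M * Real.log M + M| :=
      mul_le_mul_of_nonneg_left h2 hd.le
    have h4 : (M - ρ) * |2 * M * Real.log M + M| ≤ M * |2 * M * Real.log M + M| :=
      mul_le_mul_of_nonneg_right (by linarith) (abs_nonneg _)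
    linarith
  have e : W.Ω2 u v / ρ = (M - ρ) ^ 2 / ρ ^ 3 := by
    rw [Ω2, ← hρ]
    field_simp
    ring
  rw [e, div_div, div_le_div_iff₀ (by positivity) (by positivity)]
  have h5 : ((v - u) * (M - ρ)) ^ 2 ≤ c ^ 2 := by gcongr
  have h6 : m ^ 3 ≤ ρ ^ 3 := by gcongr
  calc (M - ρ) ^ 2 * (m ^ 3 * (v - u) ^ 2) = ((v - u) * (M - ρ)) ^ 2 * m ^ 3 := by ring
    _ ≤ c ^ 2 * ρ ^ 3 := mul_le_mul h5 h6 (by positivity) (by positivity)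

lemma strictMonoOn_r : StrictMonoOn (fun v => W.r u₀ v) (Ici v₀) := fun _ ha _ _ hab =>
  W.r_lt_r (W.dom_of_le le_rfl ha) (by linarith)

lemma tendsto_r : Tendsto (fun v => W.r u₀ v) atTop (𝓝 M) := by
  refine tendsto_order.2 ⟨fun x hx => ?_, fun x hx => ?_⟩
  · have hx' : max x (M / 2) ∈ Ioo 0 M :=
      ⟨lt_max_of_lt_right (half_pos W.hM), max_lt hx (half_lt_self W.hM)⟩
    filter_upwards [eventually_gt_atTop (rstar M (max x (M / 2)) + u₀)] with v hv
    have h := W.r_lt_r (u := 0) (v := rstar M (max x (M / 2))) (u' := u₀) (v' := v)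
      (by simpa using rstar_gt hx') (by linarith)
    rw [W.r_eq hx' (by simp)] at h
    exact (le_max_left _ _).trans_lt h
  · filter_upwards [eventually_ge_atTop v₀] with v hv
    exact (W.r_lt le_rfl hv).trans hx

end WaveSetup

namespace WaveSetup

variable {M u₀ v₀ : ℝ} (W : WaveSetup M u₀ v₀)

/-- In terms of `P = r ∂_u φ`, `Q = r ∂_v φ` and `b = Ω² / r` the wave equation is the
characteristic system `∂_v P = b Q`, `∂_u Q = -b P`. -/
lemma exists_characteristic_system : ∃ b P Q : ℝ → ℝ → ℝ,
    Continuous (Function.uncurry P) ∧ Continuous (Function.uncurry Q) ∧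
    (∀ u ≤ u₀, ∀ v ≥ v₀, b u v = W.Ω2 u v / W.r u v) ∧
    (∀ u ≤ u₀, ∀ v ≥ v₀, P u v = W.r u v * W.φu u v) ∧
    (∀ u ≤ u₀, ∀ v ≥ v₀, Q u v = W.r u v * W.φv u v) ∧
    (∀ u ≤ u₀, ∀ v ≥ v₀, ∫ y in v₀..v, b u y * Q u y = P u v - P u v₀) ∧
    (∀ u₁ u, u ≤ u₀ → u₁ ≤ u → ∀ v ≥ v₀, ∫ x in u₁..u, b x v * P x v = Q u₁ v - Q u v) := by
  obtain ⟨b, hbc, hb⟩ := exists_continuous_extension_quadrant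
    (g := fun u v => W.Ω2 u v / W.r u v) W.continuousOn_Ω2_div_r
  obtain ⟨R, hRc, hR⟩ := exists_continuous_extension_quadrant W.continuousOn_r
  obtain ⟨A, hAc, hA⟩ := exists_continuous_extension_quadrant W.hφu_cont
  obtain ⟨B, hBc, hB⟩ := exists_continuous_extension_quadrant W.hφv_cont
  have cu : ∀ {f : ℝ → ℝ → ℝ}, Continuous (Function.uncurry f) → ∀ v, Continuous fun u => f u v :=
    fun hf v => hf.comp (by fun_prop : Continuous fun x : ℝ => (x, v))
  have cv : ∀ {f : ℝ → ℝ → ℝ}, Continuous (Function.uncurry f) → ∀ u, Continuous (f u) :=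
    fun hf u => hf.comp (by fun_prop : Continuous fun x : ℝ => (u, x))
  have hFc : Continuous (Function.uncurry fun u v => b u v * (B u v - A u v)) :=
    hbc.mul (hBc.sub hAc)
  have hPc : Continuous (Function.uncurry fun u v => R u v * A u v) := hRc.mul hAc
  have hQc : Continuous (Function.uncurry fun u v => R u v * B u v) := hRc.mul hBc
  have hwave : ∀ u ≤ u₀, ∀ v ≥ v₀,
      W.r u v * W.φuv u v = W.Ω2 u v * (W.φv u v - W.φu u v) := by
    intro u hu v hv
    have := W.hwave u hu v hv
    rw [Ω2]
    linarith
  have hF : ∀ u ≤ u₀, ∀ v ≥ v₀, b u v * (B u v - A u v) = W.φuv u v := by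
    intro u hu v hv
    have hr := (W.r_pos hu hv).ne'
    rw [hb u hu v hv, hA u hu v hv, hB u hu v hv, div_mul_eq_mul_div, ← hwave u hu v hv,
      mul_div_cancel_left₀ _ hr]
  have hAint : ∀ u₁ u, u ≤ u₀ → u₁ ≤ u → ∀ v ≥ v₀,
      ∫ x in u₁..u, A x v = W.φ u v - W.φ u₁ v := by
    intro u₁ u hu hu₁ v hv
    refine integral_eq_sub_of_hasDerivWithinAt_Icc (f := fun x => W.φ x v) hu₁ (cu hAc v)
      fun x hx => ?_
    rw [hA x (hx.2.trans hu) v hv]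
    exact (W.hφu x (hx.2.trans hu) v hv).mono fun y hy => hy.2.trans hu
  have hmixed : ∀ u₁ u, u ≤ u₀ → u₁ ≤ u → ∀ v ≥ v₀,
      W.φv u v - W.φv u₁ v = ∫ x in u₁..u, b x v * (B x v - A x v) := by
    intro u₁ u hu hu₁ v hv
    refine sub_eq_integral_mixed_partial (f := W.φ) (B := W.φv) hFc (hAint u₁ u hu hu₁) hAc hu₁
      (fun x hx y hy => ?_) (W.hφv u hu) (W.hφv u₁ (hu₁.trans hu)) v hv
    have hx' := hx.2.trans hu
    rw [hA x hx' y hy, hA x hx' v₀ le_rfl]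
    refine integral_eq_sub_of_hasDerivWithinAt_Icc hy (cv hFc x) fun z hz => ?_
    rw [hF x hx' z hz.1]
    exact (W.hφuv x hx' z hz.1).mono fun _ h => h.1
  refine ⟨b, fun u v => R u v * A u v, fun u v => R u v * B u v, hPc, hQc, hb,
    fun u hu v hv => by beta_reduce; rw [hR u hu v hv, hA u hu v hv],
    fun u hu v hv => by beta_reduce; rw [hR u hu v hv, hB u hu v hv], fun u hu v hv => ?_,
    fun u₁ u hu hu₁ v hv => ?_⟩
  · beta_reduce
    rw [hR u hu v hv, hA u hu v hv, hR u hu v₀ le_rfl, hA u hu v₀ le_rfl]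
    refine integral_eq_sub_of_hasDerivWithinAt_Icc (f := fun y => W.r u y * W.φu u y) hv
      ((cv hbc u).mul (cv hQc u)) fun y hy => ?_
    refine ((W.hasDerivAt_r_v (W.dom_of_le hu hy.1)).hasDerivWithinAt.mul
      ((W.hφuv u hu y hy.1).mono fun _ h => h.1)).congr_deriv ?_
    have hr := (W.r_pos hu hy.1).ne'
    rw [hwave u hu y hy.1, hb u hu y hy.1, hR u hu y hy.1, hB u hu y hy.1]
    field_simp
    ring
  · have hu₁' := hu₁.trans hu
    beta_reduce
    rw [hR u hu v hv, hB u hu v hv, hR u₁ hu₁' v hv, hB u₁ hu₁' v hv]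
    rw [show W.r u₁ v * W.φv u₁ v - W.r u v * W.φv u v
      = (-(W.r u v * W.φv u v)) - (-(W.r u₁ v * W.φv u₁ v)) by ring]
    refine integral_eq_sub_of_hasDerivWithinAt_Icc (f := fun x => -(W.r x v * W.φv x v)) hu₁
      ((cu hbc v).mul (cu hPc v)) fun x hx => ?_
    have hx' := hx.2.trans hu
    have hd : HasDerivWithinAt (fun x => W.φv x v) (b x v * (B x v - A x v)) (Icc u₁ u) x := by
      have e : ∀ y ∈ Icc u₁ u,
          W.φv y v = W.φv u₁ v + ∫ z in u₁..y, b z v * (B z v - A z v) := fun y hy => by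
        rw [← hmixed u₁ y (hy.2.trans hu) hy.1 v hv]
        ring
      exact ((((cu hFc v).integral_hasStrictDerivAt u₁ x).hasDerivAt.const_add
        (W.φv u₁ v)).hasDerivWithinAt).congr e (e x hx)
    refine (((W.hasDerivAt_r_u (W.dom_of_le hx' hv)).hasDerivWithinAt.mul hd).neg).congr_deriv ?_
    have hr := (W.r_pos hx' hv).ne'
    rw [hF x hx' v hv, hwave x hx' v hv, hb x hx' v hv, hR x hx' v hv, hA x hx' v hv]
    field_simp
    ring

lemma integral_φv {u a v : ℝ} (hu : u ≤ u₀) (ha : v₀ ≤ a) (hav : a ≤ v) :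
    ∫ y in a..v, W.φv u y = W.φ u v - W.φ u a := by
  obtain ⟨B, hBc, hB⟩ := exists_continuous_extension_quadrant W.hφv_cont
  rw [← integral_eq_sub_of_hasDerivWithinAt_Icc (f := W.φ u) (g := B u) hav
    (hBc.comp (by fun_prop : Continuous fun x : ℝ => (u, x)))]
  · refine intervalIntegral.integral_congr fun y hy => ?_
    rw [uIcc_of_le hav] at hy
    exact (hB u hu y (ha.trans hy.1)).symm
  · intro y hy
    rw [hB u hu y (ha.trans hy.1)]
    exact (W.hφv u hu y (ha.trans hy.1)).mono fun z hz => ha.trans hz.1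

/-- If `∂_v φ` has an integrable majorant in `v`, then `φ` is Cauchy as `v → ∞`,
uniformly in `u`. -/
lemma exists_abs_sub_lt {m : ℝ → ℝ} (hm : IntegrableOn m (Ioi v₀))
    (hφm : ∀ u ≤ u₀, ∀ v ≥ v₀, |W.φv u v| ≤ m v) {ε : ℝ} (hε : 0 < ε) :
    ∃ N ≥ v₀, ∀ u ≤ u₀, ∀ v ≥ N, |W.φ u v - W.φ u N| < ε := by
  have hm0 : ∀ v ≥ v₀, 0 ≤ m v := fun v hv => (abs_nonneg _).trans (hφm u₀ le_rfl v hv)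
  have hint : ∀ a ≥ v₀, ∀ v ≥ a, IntervalIntegrable m volume a v := fun a ha v hv =>
    (intervalIntegrable_iff_integrableOn_Ioc_of_le hv).2
      (hm.mono_set fun y hy => ha.trans_lt hy.1)
  have ht := intervalIntegral_tendsto_integral_Ioi v₀ hm tendsto_id
  obtain ⟨N, hN, hNv⟩ := ((ht.eventually (lt_mem_nhds (sub_lt_self _ hε))).and
    (eventually_ge_atTop v₀)).exists
  refine ⟨N, hNv, fun u hu v hv => ?_⟩
  have h1 : |W.φ u v - W.φ u N| ≤ ∫ y in N..v, m y := by
    rw [← W.integral_φv hu hNv hv, ← Real.norm_eq_abs]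
    exact intervalIntegral.norm_integral_le_of_norm_le hv
      (Eventually.of_forall fun y hy => hφm u hu y (hNv.trans hy.1.le)) (hint N hNv v hv)
  have h2 : ∫ y in v₀..v, m y ≤ ∫ y in Ioi v₀, m y := by
    rw [intervalIntegral.integral_of_le (hNv.trans hv)]
    exact setIntegral_mono_set hm
      (ae_restrict_of_forall_mem measurableSet_Ioi fun y hy => hm0 y (le_of_lt hy))
      (Eventually.of_forall fun y hy => hy.1)
  have h3 := intervalIntegral.integral_add_adjacent_intervals
    (hint v₀ le_rfl N hNv) (hint N hNv v hv)
  simp only [id] at hN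
  linarith

/-- If `φ` is Cauchy as `v → ∞`, uniformly in `u`, it extends continuously to `V = M`. -/
lemma exists_continuousOn_extension
    (h : ∀ ε > 0, ∃ N ≥ v₀, ∀ u ≤ u₀, ∀ v ≥ N, |W.φ u v - W.φ u N| < ε) :
    ∃ Φ : ℝ → ℝ → ℝ,
      ContinuousOn (fun x : ℝ × ℝ => Φ x.1 x.2) (Iic u₀ ×ˢ Icc (W.r u₀ v₀) M) ∧
      ∀ u ≤ u₀, ∀ v : ℝ, v₀ ≤ v → Φ u (W.r u₀ v) = W.φ u v := by
  set S : Set (ℝ × ℝ) := Iic u₀ ×ˢ Ico (W.r u₀ v₀) M with hS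
  set f : ℝ × ℝ → ℝ := fun p => W.φ p.1 (rstar M p.2 + u₀) with hf
  have hV₀ : 0 < W.r u₀ v₀ := W.r_pos le_rfl le_rfl
  have hV₀M : W.r u₀ v₀ < M := W.r_lt le_rfl le_rfl
  have hle : ∀ v ≥ v₀, ∀ x, W.r u₀ v ≤ x → x < M → v ≤ rstar M x + u₀ := by
    intro v hv x hx hxM
    have h0 : 0 < W.r u₀ v := W.r_pos le_rfl hv
    have := (strictMonoOn_rstar M).monotoneOn ⟨h0.le, W.r_lt le_rfl hv⟩
      ⟨h0.le.trans hx, hxM⟩ hx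
    rw [W.hr_star u₀ v (W.dom_of_le le_rfl hv)] at this
    linarith
  have hfS : ContinuousOn f S := by
    refine W.hφ_cont.comp (f := fun p : ℝ × ℝ => (p.1, rstar M p.2 + u₀)) (fun p hp => ?_)
      fun p hp => ⟨hp.1, hle v₀ le_rfl p.2 hp.2.1 hp.2.2⟩
    exact (continuousAt_fst.prodMk ((ContinuousAt.comp (f := Prod.snd)
      (hasDerivAt_rstar hp.2.2).continuousAt continuousAt_snd).add
        continuousAt_const)).continuousWithinAt
  have hcl : Iic u₀ ×ˢ Icc (W.r u₀ v₀) M ⊆ closure S := by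
    rw [hS, closure_prod_eq, closure_Ico hV₀M.ne, isClosed_Iic.closure_eq]
  have hlim : ∀ p ∈ Iic u₀ ×ˢ Icc (W.r u₀ v₀) M, ∃ y, Tendsto f (𝓝[S] p) (𝓝 y) := by
    rintro ⟨u, x⟩ hp
    rcases eq_or_lt_of_le hp.2.2 with hx | hx
    · have : (𝓝[S] (u, x)).NeBot := mem_closure_iff_nhdsWithin_neBot.1 (hcl hp)
      refine cauchy_map_iff_exists_tendsto.1 (Metric.cauchy_iff.2 ⟨inferInstance, fun ε hε => ?_⟩)
      obtain ⟨N, hN, hNφ⟩ := h (ε / 4) (by positivity)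
      have e1 : ∀ᶠ p : ℝ × ℝ in 𝓝[S] (u, x), W.r u₀ N < p.2 := by
        refine nhdsWithin_le_nhds (continuousAt_snd.eventually (lt_mem_nhds ?_))
        simpa [show x = M from hx] using W.r_lt le_rfl hN
      have e2 : ∀ᶠ p : ℝ × ℝ in 𝓝[S] (u, x), |W.φ p.1 N - W.φ u N| < ε / 4 := by
        have hc : ContinuousWithinAt (fun p : ℝ × ℝ => W.φ p.1 N) S (u, x) :=
          ContinuousWithinAt.comp (g := fun y => W.φ y N) (f := Prod.fst) (t := Iic u₀)
            (W.hφu u hp.1 N hN).continuousWithinAt continuousWithinAt_fst fun q hq => hq.1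
        exact hc.eventually (Metric.ball_mem_nhds (W.φ u N) (by positivity : 0 < ε / 4))
      refine ⟨f '' {p | p ∈ S ∧ W.r u₀ N < p.2 ∧ |W.φ p.1 N - W.φ u N| < ε / 4},
        image_mem_map (by filter_upwards [self_mem_nhdsWithin, e1, e2] with p a b c
                          using ⟨a, b, c⟩), ?_⟩
      rintro _ ⟨p, ⟨hpS, hp1, hp2⟩, rfl⟩ _ ⟨q, ⟨hqS, hq1, hq2⟩, rfl⟩
      have a1 := hNφ p.1 hpS.1 _ (hle N hN p.2 hp1.le hpS.2.2)
      have a2 := hNφ q.1 hqS.1 _ (hle N hN q.2 hq1.le hqS.2.2)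
      rw [Real.dist_eq]
      simp only [hf]
      rw [abs_lt] at *
      constructor <;> linarith
    · exact ⟨_, hfS (u, x) ⟨hp.1, hp.2.1, hx⟩⟩
  refine ⟨fun u x => extendFrom S f (u, x), continuousOn_extendFrom hcl hlim, fun u hu v hv => ?_⟩
  have hmem : (u, W.r u₀ v) ∈ S := ⟨hu, W.r_ge le_rfl hv, W.r_lt le_rfl hv⟩
  change extendFrom S f (u, W.r u₀ v) = _
  rw [extendFrom_extends hfS _ hmem]
  simp only [hf]
  rw [W.hr_star u₀ v (W.dom_of_le le_rfl hv), sub_add_cancel]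

end WaveSetup

lemma hasDerivAt_neg_const_div_sub {K a v : ℝ} (h : v - a ≠ 0) :
    HasDerivAt (fun y => -(K / (y - a))) (K / (v - a) ^ 2) v := by
  have d := ((hasDerivAt_const v K).div ((hasDerivAt_id v).sub_const a) h).neg
  refine d.congr_deriv ?_
  simp
  ring

lemma hasDerivAt_const_div_sub {K a u : ℝ} (h : a - u ≠ 0) :
    HasDerivAt (fun x => K / (a - x)) (K / (a - u) ^ 2) u := by
  have d := (hasDerivAt_const u K).div ((hasDerivAt_id u).const_sub a) h
  refine d.congr_deriv ?_
  simp

lemma integrableOn_const_div_sub_sq {K a b : ℝ} (hK : 0 ≤ K) (hab : a < b) :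
    IntegrableOn (fun v => K / (v - a) ^ 2) (Ioi b) := by
  refine integrableOn_Ioi_deriv_of_nonneg' (g := fun v => -(K / (v - a))) (l := 0)
    (fun v hv => hasDerivAt_neg_const_div_sub (sub_pos.2 (hab.trans_le hv)).ne')
    (fun v _ => by positivity) ?_
  have := (tendsto_const_nhds (x := K)).div_atTop
    (tendsto_atTop_add_const_right atTop (-a) tendsto_id)
  simpa [sub_eq_add_neg] using this.neg

namespace WaveSetupH

variable {M u₀ v₀ : ℝ} (W : WaveSetupH M u₀ v₀)

/-- `∂_v φ` converges to `φ_H'` as `u → -∞`, so its `L¹` norm on `[v₀, V]` is eventually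
controlled by that of `φ_H'`. -/
lemma eventually_abs_φv_le {V : ℝ} (hV : v₀ ≤ V) :
    ∀ᶠ u in atBot, ∀ y ∈ Icc v₀ V, |W.φv u y| ≤ |W.φH' y| + 1 / (V - v₀ + 1) := by
  have h := (tendstoLocallyUniformlyOn_iff_tendstoUniformlyOn_of_compact isCompact_Icc).1
    (W.hφH'_tendsto.mono (show Icc v₀ V ⊆ Ici v₀ from Icc_subset_Ici_self))
  have hε : 0 < 1 / (V - v₀ + 1) := by
    have : 0 < V - v₀ + 1 := by linarith
    positivity
  filter_upwards [Metric.tendstoUniformlyOn_iff.1 h _ hε] with u hu y hy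
  have h1 := hu y hy
  rw [Real.dist_eq, abs_sub_comm] at h1
  have := abs_sub_abs_le_abs_sub (W.φv u y) (W.φH' y)
  linarith

/-- The outgoing derivative has a majorant that is integrable in `v` and independent of `u`. -/
lemma exists_integrable_majorant (hFu : IntegrableOn (fun u => |W.φu u v₀|) (Iic u₀))
    (hFv : IntegrableOn (fun v => |W.φH' v|) (Ioi v₀)) :
    ∃ m : ℝ → ℝ, IntegrableOn m (Ioi v₀) ∧ ∀ u ≤ u₀, ∀ v ≥ v₀, |W.φv u v| ≤ m v := by
  have hM := W.hM
  obtain ⟨K, hK, hbK⟩ := W.exists_Ω2_div_r_le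
  obtain ⟨b, P, Q, hPc, hQc, hb, hP, hQ, hPint, hQint⟩ := W.exists_characteristic_system
  have hd : 0 < v₀ - u₀ := W.sub_pos_of_le le_rfl le_rfl
  set k : ℝ → ℝ := fun u => K / (v₀ - min u u₀) ^ 2 with hk
  set w : ℝ → ℝ := fun v => K / (max v v₀ - u₀) ^ 2 with hw
  have hkpos : ∀ u, 0 < v₀ - min u u₀ := fun u => by linarith [min_le_right u u₀]
  have hwpos : ∀ v, 0 < max v v₀ - u₀ := fun v => by linarith [le_max_right v v₀]
  have hkc : Continuous k := continuous_const.div (by fun_prop) fun u => (pow_pos (hkpos u) 2).ne'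
  have hwc : Continuous w := continuous_const.div (by fun_prop) fun v => (pow_pos (hwpos v) 2).ne'
  have hk0 : ∀ u, 0 ≤ k u := fun u => by positivity
  have hw0 : ∀ v, 0 ≤ w v := fun v => by positivity
  have hb0 : ∀ u ≤ u₀, ∀ v ≥ v₀, |b u v| ≤ K / (v - u) ^ 2 := by
    intro u hu v hv
    have hΩ : 0 ≤ W.Ω2 u v := sq_nonneg _
    rw [hb u hu v hv, abs_of_nonneg (div_nonneg hΩ (W.r_pos hu hv).le)]
    exact hbK u hu v hv
  have hbk : ∀ u ≤ u₀, ∀ v ≥ v₀, |b u v| ≤ k u := by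
    intro u hu v hv
    refine (hb0 u hu v hv).trans ?_
    have : 0 < v₀ - u := by linarith
    simp only [hk, min_eq_left hu]
    gcongr
  have hbw : ∀ u ≤ u₀, ∀ v ≥ v₀, |b u v| ≤ w v := by
    intro u hu v hv
    refine (hb0 u hu v hv).trans ?_
    have : 0 < v - u₀ := by linarith
    simp only [hw, max_eq_left hv]
    gcongr
  set L := K / (v₀ - u₀) with hL
  have hLpos : 0 < L := div_pos hK hd
  have hkL : ∀ u₁ ≤ u₀, ∫ u in u₁..u₀, k u ≤ L := by
    intro u₁ hu₁
    rw [integral_eq_sub_of_hasDerivWithinAt_Icc (f := fun x => K / (v₀ - x)) hu₁ hkc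
      fun x hx => ?_]
    · have : 0 < v₀ - u₁ := by linarith
      exact sub_le_self _ (by positivity)
    · simp only [hk, min_eq_left hx.2]
      exact (hasDerivAt_const_div_sub (by linarith [hx.2])).hasDerivWithinAt
  have hwL : ∀ V ≥ v₀, ∫ v in v₀..V, w v ≤ L := by
    intro V hV
    rw [integral_eq_sub_of_hasDerivWithinAt_Icc (f := fun y => -(K / (y - u₀))) hV hwc
      fun x hx => ?_]
    · have : 0 < V - u₀ := by linarith
      have : 0 ≤ K / (V - u₀) := by positivity
      linarith
    · simp only [hw, max_eq_left hx.1]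
      exact (hasDerivAt_neg_const_div_sub (by linarith [hx.1])).hasDerivWithinAt
  have hPM : ∀ u ≤ u₀, ∀ v ≥ v₀, |P u v| ≤ M * |W.φu u v| := by
    intro u hu v hv
    rw [hP u hu v hv, abs_mul, abs_of_pos (W.r_pos hu hv)]
    exact mul_le_mul_of_nonneg_right (W.r_lt hu hv).le (abs_nonneg _)
  have hQM : ∀ u ≤ u₀, ∀ v ≥ v₀, |Q u v| ≤ M * |W.φv u v| := by
    intro u hu v hv
    rw [hQ u hu v hv, abs_mul, abs_of_pos (W.r_pos hu hv)]
    exact mul_le_mul_of_nonneg_right (W.r_lt hu hv).le (abs_nonneg _)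
  set C₀ := M * ∫ u in Iic u₀, |W.φu u v₀| with hC₀
  set C₁ := M * ((∫ v in Ioi v₀, |W.φH' v|) + 1) with hC₁
  have hPC : ∀ u₁ ≤ u₀, ∫ x in u₁..u₀, |P x v₀| ≤ C₀ := by
    intro u₁ hu₁
    have hi : IntervalIntegrable (fun x => M * |W.φu x v₀|) volume u₁ u₀ :=
      (intervalIntegrable_iff_integrableOn_Ioc_of_le hu₁).2
        ((hFu.mono_set Ioc_subset_Iic_self).const_mul M)
    refine (intervalIntegral.integral_mono_on hu₁ ?_ hi
      fun x hx => hPM x hx.2 v₀ le_rfl).trans ?_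
    · exact (hPc.abs.comp (by fun_prop : Continuous fun x : ℝ => (x, v₀))).intervalIntegrable _ _
    · rw [intervalIntegral.integral_const_mul, intervalIntegral.integral_of_le hu₁]
      exact mul_le_mul_of_nonneg_left (setIntegral_mono_set hFu
        (Eventually.of_forall fun _ => abs_nonneg _) Ioc_subset_Iic_self.eventuallyLE) hM.le
  have hQC : ∀ V ≥ v₀, ∀ᶠ u₁ in atBot, ∫ y in v₀..V, |Q u₁ y| ≤ C₁ := by
    intro V hV
    have hd1 : 0 < V - v₀ + 1 := by linarith
    have hi : IntervalIntegrable (fun y => |W.φH' y|) volume v₀ V :=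
      (intervalIntegrable_iff_integrableOn_Ioc_of_le hV).2 (hFv.mono_set Ioc_subset_Ioi_self)
    filter_upwards [W.eventually_abs_φv_le hV, eventually_le_atBot u₀] with u₁ h hu₁
    have h1 : ∫ y in v₀..V, |Q u₁ y| ≤ ∫ y in v₀..V, M * (|W.φH' y| + 1 / (V - v₀ + 1)) := by
      refine intervalIntegral.integral_mono_on hV ?_
        ((hi.add intervalIntegrable_const).const_mul M) fun y hy => ?_
      · exact (hQc.abs.comp
          (by fun_prop : Continuous fun y : ℝ => (u₁, y))).intervalIntegrable _ _
      · exact (hQM u₁ hu₁ y hy.1).trans (mul_le_mul_of_nonneg_left (h y hy) hM.le)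
    rw [intervalIntegral.integral_const_mul,
      intervalIntegral.integral_add hi intervalIntegrable_const,
      intervalIntegral.integral_const, smul_eq_mul] at h1
    refine h1.trans (mul_le_mul_of_nonneg_left (add_le_add ?_ ?_) hM.le)
    · rw [intervalIntegral.integral_of_le hV]
      exact setIntegral_mono_set hFv
        (Eventually.of_forall fun _ => abs_nonneg _) Ioc_subset_Ioi_self.eventuallyLE
    · rw [mul_one_div, div_le_one hd1]
      linarith
  set C := C₀ + (C₁ + L * C₀) * Real.exp (L * L) / L with hC
  have hQfin : ∀ u ≤ u₀, ∀ v ≥ v₀, |Q u v| ≤ M * |W.φH' v| + w v * C := by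
    intro u hu v hv
    have ht : Tendsto (fun u₁ => M * |W.φv u₁ v| + w v * C) atBot
        (𝓝 (M * |W.φH' v| + w v * C)) :=
      (((W.hφH'_tendsto.tendsto_at hv).abs).const_mul M).add_const _
    refine ge_of_tendsto ht ?_
    filter_upwards [hQC v hv, eventually_le_atBot u] with u₁ h hu₁
    have hu₁' := hu₁.trans hu
    refine (abs_le_of_characteristic_system hPc hQc hkc hwc hk0 hw0 hLpos hbk hbw
      (hkL u₁ hu₁') (hwL v hv) hPint (fun u hu hu₁ => hQint u₁ u hu hu₁) (hPC u₁ hu₁') hv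
      hu₁ hu ⟨hv, le_rfl⟩).trans (add_le_add (hQM u₁ hu₁' v hv) ?_)
    exact mul_le_mul_of_nonneg_left (by rw [hC]; gcongr) (hw0 v)
  have hr₀ : 0 < W.r u₀ v₀ := W.r_pos le_rfl le_rfl
  refine ⟨fun v => (M * |W.φH' v| + w v * C) / W.r u₀ v₀, ?_, fun u hu v hv => ?_⟩
  · have hwi : IntegrableOn w (Ioi v₀) :=
      (integrableOn_const_div_sub_sq hK.le (sub_pos.1 hd)).congr_fun
        (fun v hv => by simp only [hw, max_eq_left (mem_Ioi.1 hv).le]) measurableSet_Ioi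
    exact ((hFv.const_mul M).add (hwi.mul_const C)).div_const _
  · rw [le_div_iff₀ hr₀]
    refine le_trans ?_ (hQfin u hu v hv)
    rw [hQ u hu v hv, abs_mul, abs_of_pos (W.r_pos hu hv), mul_comm]
    exact mul_le_mul_of_nonneg_right (W.r_ge hu hv) (abs_nonneg _)

/-- Since `|u|` is bounded below on `u ≤ u₀ < 0`, weighted integrability of `∂_u φ` on `v = v₀`
implies integrability. -/
lemma integrableOn_abs_φu {p : ℝ} (hp : 0 ≤ p)
    (hFu : IntegrableOn (fun u => |u| ^ p * |W.φu u v₀|) (Iic u₀)) :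
    IntegrableOn (fun u => |W.φu u v₀|) (Iic u₀) := by
  have hu₀ : 0 < |u₀| := abs_pos.2 W.hu₀.ne
  have hc : ContinuousOn (fun u => |W.φu u v₀|) (Iic u₀) :=
    (W.hφu_cont.comp (f := fun u : ℝ => (u, v₀)) (by fun_prop)
      fun u hu => ⟨hu, le_refl v₀⟩).abs
  refine Integrable.mono' (hFu.const_mul ((|u₀| ^ p)⁻¹))
    (hc.aestronglyMeasurable measurableSet_Iic)
    (ae_restrict_of_forall_mem measurableSet_Iic fun u hu => ?_)
  have hle : |u₀| ^ p ≤ |u| ^ p := by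
    refine Real.rpow_le_rpow hu₀.le ?_ hp
    rw [abs_of_neg W.hu₀, abs_of_neg (lt_of_le_of_lt hu W.hu₀)]
    exact neg_le_neg hu
  rw [Real.norm_eq_abs, abs_abs, inv_mul_eq_div, le_div_iff₀ (Real.rpow_pos_of_pos hu₀ p),
    mul_comm]
  exact mul_le_mul_of_nonneg_right hle (abs_nonneg _)

end WaveSetupH

/-- **`C⁰`-extendibility of `φ₀` beyond the Cauchy horizon** (Proposition 4.10):
if `F_p[φ] = ∫_{-∞}^{u₀} |u'|^p |∂_u φ|(u',v₀) du' + ∫_{v₀}^∞ |φ_H'| dv' < ∞` for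
some `0 ≤ p < 1`, then in the regular outgoing coordinate `V(v) := r(u₀,v)` (which
is strictly increasing with `V → M`, the Cauchy horizon), `φ` extends continuously
to `(-∞,u₀] × [V₀,M]`. -/
theorem C0_extendibility (M u₀ v₀ : ℝ) (W : WaveSetupH M u₀ v₀)
    (p : ℝ) (hp₁ : 0 ≤ p) (hp₂ : p < 1)
    (hFu : IntegrableOn (fun u' => |u'| ^ p * |W.φu u' v₀|) (Set.Iic u₀))
    (hFv : IntegrableOn (fun v' => |W.φH' v'|) (Set.Ioi v₀)) :
    StrictMonoOn (fun v => W.r u₀ v) (Set.Ici v₀) ∧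
    Tendsto (fun v => W.r u₀ v) atTop (𝓝 M) ∧
    ∃ Φ : ℝ → ℝ → ℝ,
      ContinuousOn (fun x : ℝ × ℝ => Φ x.1 x.2)
        (Set.Iic u₀ ×ˢ Set.Icc (W.r u₀ v₀) M) ∧
      ∀ u ≤ u₀, ∀ v : ℝ, v₀ ≤ v → Φ u (W.r u₀ v) = W.φ u v := by
  obtain ⟨m, hm, hφm⟩ := W.exists_integrable_majorant (W.integrableOn_abs_φu hp₁ hFu) hFv
  exact ⟨W.strictMonoOn_r, W.tendsto_r,
    W.exists_continuousOn_extension fun _ hε => W.exists_abs_sub_lt hm hφm hε⟩
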